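/- The metric d = ρ + ρ* on I(ℕ) is a complete metric whose induced topology is τ_pp; in particular (I(ℕ), τ_pp) is a Polish topological inverse semigroup. -/

import Mathlib

open TopologicalSpace Filter

/-- A partial bijection on `X`, represented by its graph. -/
structure PartialBij (X : Type*) where
  graph : Set (X × X)
  functional : ∀ ⦃x y y'⦄, (x, y) ∈ graph → (x, y') ∈ graph → y = y'
  coinjective : ∀ ⦃x x' y⦄, (x, y) ∈ graph → (x', y) ∈ graph → x = x'

namespace PartialBij

variable {X : Type*}

/-- Composition `f ∘ g` of partial bijections. -/
def comp (f g : PartialBij X) : PartialBij X where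
  graph := {p | ∃ y, (p.1, y) ∈ g.graph ∧ (y, p.2) ∈ f.graph}
  functional := by
    rintro x y y' ⟨z, hz1, hz2⟩ ⟨z', hz1', hz2'⟩
    obtain rfl := g.functional hz1 hz1'
    exact f.functional hz2 hz2'
  coinjective := by
    rintro x x' y ⟨z, hz1, hz2⟩ ⟨z', hz1', hz2'⟩
    obtain rfl := f.coinjective hz2 hz2'
    exact g.coinjective hz1 hz1'

/-- Inversion `f ↦ f⁻¹` of partial bijections. -/
def inv (f : PartialBij X) : PartialBij X where
  graph := {p | (p.2, p.1) ∈ f.graph}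
  functional := fun _ _ _ h h' => f.coinjective h h'
  coinjective := fun _ _ _ h h' => f.functional h h'

/-- Domain of a partial bijection. -/
def dom (f : PartialBij X) : Set X := {x | ∃ y, (x, y) ∈ f.graph}

/-- Image of a partial bijection. -/
def im (f : PartialBij X) : Set X := {y | ∃ x, (x, y) ∈ f.graph}

/-- `v x y = {f : x ∈ dom f and f(x) = y}`. -/
def v (x y : X) : Set (PartialBij X) := {f | (x, y) ∈ f.graph}

/-- `w₁ x = {f : x ∉ dom f}`. -/
def w1 (x : X) : Set (PartialBij X) := {f | x ∉ f.dom}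

/-- `w₂ y = {f : y ∉ im f}`. -/
def w2 (y : X) : Set (PartialBij X) := {f | y ∉ f.im}

/-- The topology generated by the sets `v x y`. -/
def tau0 (X : Type*) : TopologicalSpace (PartialBij X) :=
  generateFrom {s | ∃ x y, s = v x y}

/-- The topology generated by the sets `v x y` and `w₁ x`. -/
def tau1 (X : Type*) : TopologicalSpace (PartialBij X) :=
  generateFrom ({s | ∃ x y, s = v x y} ∪ {s | ∃ x, s = w1 x})

/-- The topology generated by the sets `v x y` and `w₂ y`. -/
def tau2 (X : Type*) : TopologicalSpace (PartialBij X) :=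
  generateFrom ({s | ∃ x y, s = v x y} ∪ {s | ∃ y, s = w2 y})

/-- The partial product topology, generated by the sets `v x y`, `w₁ x` and `w₂ y`. -/
def taupp (X : Type*) : TopologicalSpace (PartialBij X) :=
  generateFrom ({s | ∃ x y, s = v x y} ∪ {s | ∃ x, s = w1 x} ∪ {s | ∃ y, s = w2 y})

/-- The partial identity `1_A` on `A ⊆ X`. -/
def partialId (A : Set X) : PartialBij X where
  graph := {p | p.1 ∈ A ∧ p.1 = p.2}
  functional := by rintro x y y' ⟨_, h⟩ ⟨_, h'⟩; exact h.symm.trans h'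
  coinjective := by rintro x x' y ⟨_, h⟩ ⟨_, h'⟩; exact h.trans h'.symm

/-- The product (Cantor) topology on the power set `2^X`. -/
def cantorTop (X : Type*) : TopologicalSpace (Set X) :=
  generateFrom ({s | ∃ x, s = {A : Set X | x ∈ A}} ∪ {s | ∃ x, s = {A : Set X | x ∉ A}})

open Classical in
/-- Evaluation of a partial bijection at a point of its domain (with junk value `x`
  outside of the domain). -/
noncomputable def evalAt (x : X) (f : PartialBij X) : X :=
  if h : x ∈ f.dom then h.choose else x

end PartialBij

namespace PartialBij

open Classical in
/-- `a_{(f,g)}(n)`: 0 if `n` belongs to both or neither of the domains, 1 otherwise. -/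
noncomputable def aFn (f g : PartialBij ℕ) (n : ℕ) : ℝ :=
  if n ∈ f.dom ↔ n ∈ g.dom then 0 else 1

open Classical in
/-- `b_{(f,g)}(n)`: `min {1, |f(n) - g(n)|}` if `n` is in both domains, `0` otherwise. -/
noncomputable def bFn (f g : PartialBij ℕ) (n : ℕ) : ℝ :=
  if n ∈ f.dom ∧ n ∈ g.dom then min 1 (Nat.dist (evalAt n f) (evalAt n g)) else 0

/-- The metric `ρ(f,g) = Σ_n (a_{(f,g)}(n) + b_{(f,g)}(n)) / 2ⁿ` on `I(ℕ)`. -/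
noncomputable def rho (f g : PartialBij ℕ) : ℝ :=
  ∑' n : ℕ, (aFn f g n + bFn f g n) / 2 ^ n

/-- The metric `d = ρ + ρ*`, where `ρ*(f,g) = ρ(f⁻¹, g⁻¹)`. -/
noncomputable def dMetric (f g : PartialBij ℕ) : ℝ :=
  rho f g + rho f.inv g.inv

end PartialBij

namespace PartialBij

theorem ext_graph {f g : PartialBij ℕ} (h : f.graph = g.graph) : f = g := by
  cases f; cases g; cases h; rfl

/-- `f` and `g` agree at `n`. -/
def Agree (f g : PartialBij ℕ) (n : ℕ) : Prop :=
  ∀ y, (n, y) ∈ f.graph ↔ (n, y) ∈ g.graph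

theorem Agree.symm {f g : PartialBij ℕ} {n : ℕ} (h : Agree f g n) : Agree g f n :=
  fun y => (h y).symm

theorem Agree.trans {f g k : PartialBij ℕ} {n : ℕ} (h : Agree f g n) (h' : Agree g k n) :
    Agree f k n := fun y => (h y).trans (h' y)

theorem evalAt_eq {f : PartialBij ℕ} {n y : ℕ} (h : (n, y) ∈ f.graph) : evalAt n f = y := by
  have hd : n ∈ f.dom := ⟨y, h⟩
  unfold evalAt
  rw [dif_pos hd]
  exact f.functional hd.choose_spec h

open Classical in
/-- The `0`-`1` disagreement indicator. -/
noncomputable def cFn (f g : PartialBij ℕ) (n : ℕ) : ℝ := if Agree f g n then 0 else 1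

theorem ab_eq (f g : PartialBij ℕ) (n : ℕ) : aFn f g n + bFn f g n = cFn f g n := by
  unfold aFn bFn cFn
  by_cases hf : n ∈ f.dom <;> by_cases hg : n ∈ g.dom
  · obtain ⟨y, hy⟩ := hf
    obtain ⟨z, hz⟩ := hg
    have hf : n ∈ f.dom := ⟨y, hy⟩
    have hg : n ∈ g.dom := ⟨z, hz⟩
    simp only [hf, hg, evalAt_eq hy, evalAt_eq hz, and_self, if_true]
    by_cases hyz : y = z
    · subst hyz
      have : Agree f g n := fun w =>
        ⟨fun h => f.functional hy h ▸ hz, fun h => g.functional hz h ▸ hy⟩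
      simp [this, Nat.dist_self]
    · have : ¬ Agree f g n := fun h => hyz (g.functional ((h y).1 hy) hz)
      have h1 : 1 ≤ Nat.dist y z := Nat.dist_pos_of_ne hyz
      have h2 : (1 : ℝ) ≤ (Nat.dist y z : ℝ) := by exact_mod_cast h1
      simp [this, h2]
  · have : ¬ Agree f g n := by
      rintro h
      obtain ⟨y, hy⟩ := hf
      exact hg ⟨y, (h y).1 hy⟩
    simp [hf, hg, this]
  · have : ¬ Agree f g n := by
      rintro h
      obtain ⟨y, hy⟩ := hg
      exact hf ⟨y, (h y).2 hy⟩
    simp [hf, hg, this]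
  · have : Agree f g n := fun y => ⟨fun h => (hf ⟨y, h⟩).elim, fun h => (hg ⟨y, h⟩).elim⟩
    simp [hf, hg, this]

theorem cFn_nonneg (f g : PartialBij ℕ) (n : ℕ) : 0 ≤ cFn f g n := by
  unfold cFn; split_ifs <;> norm_num

theorem cFn_le_one (f g : PartialBij ℕ) (n : ℕ) : cFn f g n ≤ 1 := by
  unfold cFn; split_ifs <;> norm_num

theorem cFn_triangle (f g k : PartialBij ℕ) (n : ℕ) : cFn f k n ≤ cFn f g n + cFn g k n := by
  by_cases h1 : Agree f g n
  · by_cases h2 : Agree g k n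
    · simp [cFn, h1, h2, h1.trans h2]
    · have := cFn_le_one f k n
      have := cFn_nonneg f g n
      have : cFn g k n = 1 := by simp [cFn, h2]
      linarith
  · have := cFn_le_one f k n
    have := cFn_nonneg g k n
    have : cFn f g n = 1 := by simp [cFn, h1]
    linarith

theorem cFn_comm (f g : PartialBij ℕ) (n : ℕ) : cFn f g n = cFn g f n := by
  have : Agree f g n ↔ Agree g f n := ⟨Agree.symm, Agree.symm⟩
  unfold cFn
  by_cases h : Agree f g n
  · rw [if_pos h, if_pos (this.1 h)]
  · rw [if_neg h, if_neg (fun h' => h (this.2 h'))]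

theorem rho_eq (f g : PartialBij ℕ) : rho f g = ∑' n : ℕ, cFn f g n / 2 ^ n := by
  simp only [rho, ab_eq]

theorem summable_c (f g : PartialBij ℕ) : Summable (fun n : ℕ => cFn f g n / 2 ^ n) := by
  refine Summable.of_nonneg_of_le (fun n => div_nonneg (cFn_nonneg f g n) (by positivity))
    (fun n => ?_) summable_geometric_two
  rw [one_div, inv_pow, ← one_div]
  gcongr
  exact cFn_le_one f g n

theorem rho_nonneg (f g : PartialBij ℕ) : 0 ≤ rho f g := by
  rw [rho_eq]
  exact tsum_nonneg fun n => div_nonneg (cFn_nonneg f g n) (by positivity)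

theorem rho_comm (f g : PartialBij ℕ) : rho f g = rho g f := by
  simp only [rho_eq, cFn_comm f g]

theorem rho_self (f : PartialBij ℕ) : rho f f = 0 := by
  have : ∀ n, Agree f f n := fun n y => Iff.rfl
  simp [rho_eq, cFn, this]

theorem rho_triangle (f g k : PartialBij ℕ) : rho f k ≤ rho f g + rho g k := by
  simp only [rho_eq]
  rw [← (summable_c f g).tsum_add (summable_c g k)]
  refine (summable_c f k).tsum_le_tsum (fun n => ?_) ((summable_c f g).add (summable_c g k))
  rw [← add_div]
  gcongr
  exact cFn_triangle f g k n

theorem agree_of_rho {f g : PartialBij ℕ} {n : ℕ} (h : rho f g < (1 / 2) ^ n) {m : ℕ}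
    (hm : m ≤ n) : Agree f g m := by
  by_contra hc
  have h1 : cFn f g m / 2 ^ m ≤ rho f g := by
    rw [rho_eq]
    exact (summable_c f g).le_tsum m
      (fun n _ => div_nonneg (cFn_nonneg f g n) (by positivity))
  have h2 : cFn f g m = 1 := by simp [cFn, hc]
  have h3 : ((1 : ℝ) / 2) ^ n ≤ (1 / 2) ^ m :=
    pow_le_pow_of_le_one (by norm_num) (by norm_num) hm
  rw [h2, ← one_div_pow] at h1
  linarith

theorem rho_le_of_agree {f g : PartialBij ℕ} {n : ℕ} (h : ∀ m < n, Agree f g m) :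
    rho f g ≤ 2 * (1 / 2) ^ n := by
  rw [rho_eq, ← (summable_c f g).sum_add_tsum_nat_add n]
  have h0 : ∑ i ∈ Finset.range n, cFn f g i / 2 ^ i = 0 := by
    refine Finset.sum_eq_zero fun i hi => ?_
    simp [cFn, h i (Finset.mem_range.1 hi)]
  rw [h0, zero_add]
  have hs : Summable fun i : ℕ => ((1 : ℝ) / 2) ^ i * (1 / 2) ^ n :=
    summable_geometric_two.mul_right _
  calc ∑' i : ℕ, cFn f g (i + n) / 2 ^ (i + n)
      ≤ ∑' i : ℕ, ((1 : ℝ) / 2) ^ i * (1 / 2) ^ n := by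
        refine Summable.tsum_le_tsum (fun i => ?_)
          ((summable_nat_add_iff n).2 (summable_c f g)) hs
        rw [← pow_add, one_div_pow]
        gcongr
        exact cFn_le_one f g _
    _ = 2 * (1 / 2) ^ n := by rw [tsum_mul_right, tsum_geometric_two]

/-- The metric space structure given by `dMetric`. -/
noncomputable abbrev dSpace : MetricSpace (PartialBij ℕ) where
  dist := dMetric
  dist_self f := by simp [dMetric, rho_self]
  dist_comm f g := by simp [dMetric, rho_comm f g, rho_comm f.inv g.inv]
  dist_triangle f g k := by
    have := rho_triangle f g k
    have := rho_triangle f.inv g.inv k.inv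
    simp only [dMetric]
    linarith
  eq_of_dist_eq_zero {f g} h := by
    have h1 := rho_nonneg f g
    have h2 := rho_nonneg f.inv g.inv
    have h3 : rho f g = 0 := by
      change rho f g + rho f.inv g.inv = 0 at h
      linarith
    apply ext_graph
    ext ⟨x, y⟩
    exact agree_of_rho (n := x) (by rw [h3]; positivity) le_rfl y

theorem agree_of_d {f g : PartialBij ℕ} {n : ℕ} (h : dMetric f g < (1 / 2) ^ n) {m : ℕ}
    (hm : m ≤ n) : Agree f g m ∧ Agree f.inv g.inv m := by
  have h1 := rho_nonneg f g
  have h2 := rho_nonneg f.inv g.inv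
  unfold dMetric at h
  exact ⟨agree_of_rho (by linarith) hm, agree_of_rho (n := n) (by linarith) hm⟩

theorem exists_d_lt {ε : ℝ} (hε : 0 < ε) : ∃ n : ℕ, ∀ f g : PartialBij ℕ,
    (∀ m < n, Agree f g m ∧ Agree f.inv g.inv m) → dMetric f g < ε := by
  obtain ⟨n, hn⟩ := exists_pow_lt_of_lt_one (show 0 < ε / 4 by linarith)
    (show (1 : ℝ) / 2 < 1 by norm_num)
  refine ⟨n, fun f g h => ?_⟩
  have h1 := rho_le_of_agree fun m hm => (h m hm).1
  have h2 := rho_le_of_agree fun m hm => (h m hm).2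
  unfold dMetric
  linarith

theorem isOpen_v (x y : ℕ) : @IsOpen _ (taupp ℕ) (v x y) :=
  isOpen_generateFrom_of_mem (Or.inl (Or.inl ⟨x, y, rfl⟩))

theorem isOpen_w1 (x : ℕ) : @IsOpen _ (taupp ℕ) (w1 x) :=
  isOpen_generateFrom_of_mem (Or.inl (Or.inr ⟨x, rfl⟩))

theorem isOpen_w2 (x : ℕ) : @IsOpen _ (taupp ℕ) (w2 x) :=
  isOpen_generateFrom_of_mem (Or.inr ⟨x, rfl⟩)

theorem continuous_inv' : @Continuous _ _ (taupp ℕ) (taupp ℕ) (inv (X := ℕ)) := by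
  letI := taupp ℕ
  refine continuous_generateFrom_iff.2 ?_
  rintro s ((⟨x, y, rfl⟩ | ⟨x, rfl⟩) | ⟨x, rfl⟩)
  · exact isOpen_v y x
  · exact isOpen_w2 x
  · exact isOpen_w1 x

theorem isOpen_agree (f : PartialBij ℕ) (n : ℕ) : @IsOpen _ (taupp ℕ) {g | Agree f g n} := by
  by_cases hf : n ∈ f.dom
  · obtain ⟨y, hy⟩ := hf
    have : {g | Agree f g n} = v n y := by
      ext g
      refine ⟨fun h => (h y).1 hy, fun hg w => ?_⟩
      exact ⟨fun h => f.functional hy h ▸ hg, fun h => g.functional hg h ▸ hy⟩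
    rw [this]
    exact isOpen_v n y
  · have : {g | Agree f g n} = w1 n := by
      ext g
      refine ⟨fun h => ?_, fun hg w => ?_⟩
      · rintro ⟨y, hy⟩
        exact hf ⟨y, (h y).2 hy⟩
      · exact ⟨fun h => (hf ⟨w, h⟩).elim, fun h => (hg ⟨w, h⟩).elim⟩
    rw [this]
    exact isOpen_w1 n

theorem dSpace_top : dSpace.toUniformSpace.toTopologicalSpace = taupp ℕ := by
  apply le_antisymm
  · refine le_generateFrom ?_
    letI := dSpace
    have key : ∀ (s : Set (PartialBij ℕ)) (n : ℕ),
        (∀ f g, Agree f g n → Agree f.inv g.inv n → f ∈ s → g ∈ s) → IsOpen s := by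
      intro s n h
      refine Metric.isOpen_iff.2 fun f hf => ⟨(1 / 2) ^ n, by positivity, fun g hg => ?_⟩
      rw [Metric.mem_ball, dist_comm] at hg
      have := agree_of_d hg le_rfl
      exact h f g this.1 this.2 hf
    rintro s ((⟨x, y, rfl⟩ | ⟨x, rfl⟩) | ⟨x, rfl⟩)
    · exact key _ x fun f g h _ hf => (h y).1 hf
    · exact key _ x fun f g h _ hf ⟨y, hy⟩ => hf ⟨y, (h y).2 hy⟩
    · exact key _ x fun f g _ h hf ⟨y, hy⟩ => hf ⟨y, (h y).2 hy⟩
  · intro U hU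
    have hU' := (@Metric.isOpen_iff _ dSpace.toPseudoMetricSpace U).1 hU
    letI := taupp ℕ
    refine isOpen_iff_forall_mem_open.2 fun f hf => ?_
    obtain ⟨ε, hε, hb⟩ := hU' f hf
    obtain ⟨n, hn⟩ := exists_d_lt hε
    refine ⟨⋂ m ∈ Set.Iio n, ({g | Agree f g m} ∩ inv ⁻¹' {g | Agree f.inv g m}), ?_, ?_, ?_⟩
    · intro g hg
      apply hb
      rw [@Metric.mem_ball, @dist_comm _ dSpace.toPseudoMetricSpace]
      refine hn f g fun m hm => ?_
      exact Set.mem_iInter₂.1 hg m hm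
    · refine (Set.finite_Iio n).isOpen_biInter fun m _ => ?_
      exact (isOpen_agree f m).inter ((isOpen_agree f.inv m).preimage continuous_inv')
    · exact Set.mem_iInter₂.2 fun m _ => ⟨fun y => Iff.rfl, fun y => Iff.rfl⟩

theorem dSpace_complete : @CompleteSpace _ dSpace.toUniformSpace := by
  letI := dSpace
  refine Metric.complete_of_cauchySeq_tendsto fun u hu => ?_
  have hN : ∀ n : ℕ, ∃ N, ∀ k ≥ N, ∀ m ≤ n,
      Agree (u k) (u N) m ∧ Agree (u k).inv (u N).inv m := by
    intro n
    obtain ⟨N, hN⟩ := Metric.cauchySeq_iff'.1 hu ((1 / 2) ^ n) (by positivity)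
    exact ⟨N, fun k hk m hm => agree_of_d (hN k hk) hm⟩
  let L : PartialBij ℕ :=
    { graph := {p | ∀ᶠ k in atTop, p ∈ (u k).graph}
      functional := fun x y y' h h' => by
        obtain ⟨k, hk, hk'⟩ := (Filter.Eventually.and h h').exists
        exact (u k).functional hk hk'
      coinjective := fun x x' y h h' => by
        obtain ⟨k, hk, hk'⟩ := (Filter.Eventually.and h h').exists
        exact (u k).coinjective hk hk' }
  refine ⟨L, Metric.tendsto_atTop.2 fun ε hε => ?_⟩
  obtain ⟨n, hn⟩ := exists_d_lt hε
  obtain ⟨N, hN⟩ := hN n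
  refine ⟨N, fun k hk => hn _ _ fun m hm => ⟨fun y => ?_, fun y => ?_⟩⟩
  · constructor
    · intro h
      filter_upwards [eventually_ge_atTop N] with j hj
      exact ((hN j hj m hm.le).1 y).2 (((hN k hk m hm.le).1 y).1 h)
    · intro h
      obtain ⟨j, hj, hj'⟩ := (Filter.Eventually.and h (eventually_ge_atTop N)).exists
      exact ((hN k hk m hm.le).1 y).2 (((hN j hj' m hm.le).1 y).1 hj)
  · constructor
    · intro h
      change ∀ᶠ j in atTop, (y, m) ∈ (u j).graph
      filter_upwards [eventually_ge_atTop N] with j hj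
      exact ((hN j hj m hm.le).2 y).2 (((hN k hk m hm.le).2 y).1 h)
    · intro h
      change ∀ᶠ j in atTop, (y, m) ∈ (u j).graph at h
      obtain ⟨j, hj, hj'⟩ := (Filter.Eventually.and h (eventually_ge_atTop N)).exists
      exact ((hN k hk m hm.le).2 y).2 (((hN j hj' m hm.le).2 y).1 hj)

theorem taupp_polish : @PolishSpace (PartialBij ℕ) (taupp ℕ) := by
  have h2 : @SecondCountableTopology _ (taupp ℕ) := by
    letI := taupp ℕ
    refine ⟨_, ?_, rfl⟩
    refine Set.Countable.union (Set.Countable.union ?_ ?_) ?_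
    · refine (Set.countable_range fun p : ℕ × ℕ => v p.1 p.2).mono ?_
      rintro s ⟨x, y, rfl⟩
      exact ⟨(x, y), rfl⟩
    · refine (Set.countable_range fun p : ℕ => w1 p).mono ?_
      rintro s ⟨x, rfl⟩
      exact ⟨x, rfl⟩
    · refine (Set.countable_range fun p : ℕ => w2 p).mono ?_
      rintro s ⟨x, rfl⟩
      exact ⟨x, rfl⟩
  letI := taupp ℕ
  haveI := h2
  haveI : IsCompletelyMetrizableSpace (PartialBij ℕ) := ⟨dSpace, dSpace_top, dSpace_complete⟩
  exact {}

theorem continuous_comp' : @Continuous (PartialBij ℕ × PartialBij ℕ) (PartialBij ℕ)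
      (@instTopologicalSpaceProd _ _ (taupp ℕ) (taupp ℕ)) (taupp ℕ)
      (fun p => p.1.comp p.2) := by
  letI := taupp ℕ
  refine continuous_generateFrom_iff.2 ?_
  rintro s ((⟨x, y, rfl⟩ | ⟨x, rfl⟩) | ⟨y, rfl⟩)
  · have : (fun p : PartialBij ℕ × PartialBij ℕ => p.1.comp p.2) ⁻¹' v x y
        = ⋃ z, (v z y) ×ˢ (v x z) := by
      ext ⟨f, g⟩
      simp only [Set.mem_preimage, Set.mem_iUnion, Set.mem_prod]
      exact ⟨fun ⟨z, h1, h2⟩ => ⟨z, h2, h1⟩, fun ⟨z, h1, h2⟩ => ⟨z, h2, h1⟩⟩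
    rw [this]
    exact isOpen_iUnion fun z => (isOpen_v z y).prod (isOpen_v x z)
  · have : (fun p : PartialBij ℕ × PartialBij ℕ => p.1.comp p.2) ⁻¹' w1 x
        = Set.univ ×ˢ w1 x ∪ ⋃ z, (w1 z) ×ˢ (v x z) := by
      ext ⟨f, g⟩
      simp only [Set.mem_preimage, Set.mem_iUnion, Set.mem_prod, Set.mem_union, Set.mem_univ,
        true_and]
      constructor
      · intro h
        by_cases hx : x ∈ g.dom
        · obtain ⟨z, hz⟩ := hx
          exact Or.inr ⟨z, fun ⟨y, hy⟩ => h ⟨y, z, hz, hy⟩, hz⟩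
        · exact Or.inl hx
      · rintro (h | ⟨z, h1, h2⟩) ⟨y, w, hw1, hw2⟩
        · exact h ⟨w, hw1⟩
        · exact h1 ⟨y, g.functional hw1 h2 ▸ hw2⟩
    rw [this]
    exact (isOpen_univ.prod (isOpen_w1 x)).union
      (isOpen_iUnion fun z => (isOpen_w1 z).prod (isOpen_v x z))
  · have : (fun p : PartialBij ℕ × PartialBij ℕ => p.1.comp p.2) ⁻¹' w2 y
        = w2 y ×ˢ Set.univ ∪ ⋃ z, (v z y) ×ˢ (w2 z) := by
      ext ⟨f, g⟩
      simp only [Set.mem_preimage, Set.mem_iUnion, Set.mem_prod, Set.mem_union, Set.mem_univ,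
        and_true]
      constructor
      · intro h
        by_cases hx : y ∈ f.im
        · obtain ⟨z, hz⟩ := hx
          exact Or.inr ⟨z, hz, fun ⟨x, hx⟩ => h ⟨x, z, hx, hz⟩⟩
        · exact Or.inl hx
      · rintro (h | ⟨z, h1, h2⟩) ⟨x, w, hw1, hw2⟩
        · exact h ⟨w, hw2⟩
        · exact h2 ⟨x, f.coinjective hw2 h1 ▸ hw1⟩
    rw [this]
    exact ((isOpen_w2 y).prod isOpen_univ).union
      (isOpen_iUnion fun z => (isOpen_v z y).prod (isOpen_w2 z))

end PartialBij

open PartialBij in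
/-- `d = ρ + ρ*` is a complete metric on `I(ℕ)` inducing `τ_pp`; in particular
`(I(ℕ), τ_pp)` is a Polish topological inverse semigroup. -/
theorem d_complete_metric_for_taupp :
    (∃ m : MetricSpace (PartialBij ℕ),
      (∀ f g : PartialBij ℕ, @dist (PartialBij ℕ) m.toDist f g = dMetric f g) ∧
      m.toUniformSpace.toTopologicalSpace = taupp ℕ ∧
      @CompleteSpace (PartialBij ℕ) m.toUniformSpace) ∧
    @PolishSpace (PartialBij ℕ) (taupp ℕ) ∧
    @Continuous (PartialBij ℕ × PartialBij ℕ) (PartialBij ℕ)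
      (@instTopologicalSpaceProd _ _ (taupp ℕ) (taupp ℕ)) (taupp ℕ)
      (fun p => p.1.comp p.2) ∧
    @Continuous (PartialBij ℕ) (PartialBij ℕ) (taupp ℕ) (taupp ℕ) inv := by
  exact ⟨⟨dSpace, fun _ _ => rfl, dSpace_top, dSpace_complete⟩, taupp_polish,
    continuous_comp', continuous_inv'⟩
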